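/- Let G be a finite abelian group with invariant factor decomposition G ≅ ℤ/m₁ℤ ⊕ ⋯ ⊕ ℤ/m_kℤ where m₁ ∣ m₂ ∣ ⋯ ∣ m_k, and let n = rk₄(G) be the number of indices i with 4 ∣ m_i. Then r₃(G) ≤ 4^(−(1−γ)n)·|G|, where γ = sup{ (1/2)(H(1/2 − ε) + H(2ε)) : 0 < ε < 1/4 } ≈ 0.926. -/

import Mathlib

/-- A set `A` in an additively written abelian group is progression-free if there do not
exist pairwise distinct `a, b, c ∈ A` with `a + b = 2c`. -/
def ProgressionFree {G : Type*} [AddCommGroup G] (A : Set G) : Prop :=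
  ¬ ∃ a ∈ A, ∃ b ∈ A, ∃ c ∈ A, a ≠ b ∧ a ≠ c ∧ b ≠ c ∧ a + b = c + c

/-- `r₃(G)`: the largest size of a progression-free subset of `G`. -/
noncomputable def r3 (G : Type*) [AddCommGroup G] [Fintype G] : ℕ :=
  sSup {N : ℕ | ∃ A : Finset G, ProgressionFree (A : Set G) ∧ A.card = N}

/-- The binary entropy function `H(x) = -x log₂ x - (1-x) log₂ (1-x)`. -/
noncomputable def binEnt (x : ℝ) : ℝ :=
  -x * Real.logb 2 x - (1 - x) * Real.logb 2 (1 - x)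

/-- `γ = sup { (1/2)(H(1/2-ε) + H(2ε)) : 0 < ε < 1/4 } ≈ 0.926`. -/
noncomputable def gam : ℝ :=
  sSup ((fun ε : ℝ => (1 / 2) * (binEnt (1 / 2 - ε) + binEnt (2 * ε))) ''
    Set.Ioo 0 (1 / 4))

open Finset

/-- The number of subsets of size at most `j` of a set of size `N`. -/
def chooseSum (N j : ℕ) : ℕ := ∑ i ∈ range (j + 1), N.choose i

theorem card_filter_card_le (ι : Type*) [Fintype ι] [DecidableEq ι] (j : ℕ) :
    #{S : Finset ι | #S ≤ j} = chooseSum (Fintype.card ι) j := by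
  rw [card_eq_sum_card_fiberwise (f := card) (t := range (j + 1)), chooseSum]
  · refine sum_congr rfl fun i hi => ?_
    rw [← Fintype.card_finset_len, Fintype.card_subtype, filter_filter]
    congr 1
    ext S
    simp only [mem_filter, mem_univ, true_and, mem_range] at hi ⊢
    omega
  · intro S hS
    simpa [Nat.lt_succ_iff] using hS

theorem card_filter_lt_card_compl (ι : Type*) [Fintype ι] [DecidableEq ι] (D : ℕ) :
    #{S : Finset ι | D < #Sᶜ} + chooseSum (Fintype.card ι) D = 2 ^ Fintype.card ι := by
  have h : #{S : Finset ι | #Sᶜ ≤ D} = chooseSum (Fintype.card ι) D := by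
    rw [← card_filter_card_le]
    exact card_bij' (fun S _ => Sᶜ) (fun S _ => Sᶜ) (by simp) (by simp) (by simp) (by simp)
  rw [← h, ← Fintype.card_finset, ← card_univ,
    ← card_filter_add_card_filter_not (s := univ) (fun S : Finset ι => D < #Sᶜ)]
  simp

theorem Matrix.rank_add_le {m n K : Type*} [Fintype m] [Fintype n] [Field K] (A B : Matrix m n K) :
    (A + B).rank ≤ A.rank + B.rank := by
  have h : LinearMap.range (A + B).mulVecLin ≤
      LinearMap.range A.mulVecLin ⊔ LinearMap.range B.mulVecLin := by
    rintro _ ⟨v, rfl⟩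
    rw [Matrix.mulVecLin_add]
    exact Submodule.add_mem_sup ⟨v, rfl⟩ ⟨v, rfl⟩
  exact (Submodule.finrank_mono h).trans (Submodule.finrank_add_le_finrank_add_finrank _ _)

section Polynomial

variable {ι : Type*} [Fintype ι] [DecidableEq ι]

/-- The value at `x` of the multilinear polynomial with coefficients `c`. -/
def multilinearEval (c : Finset ι → ZMod 2) (x : ι → ZMod 2) : ZMod 2 :=
  ∑ S, c S * ∏ i ∈ S, x i

theorem exists_multilinearEval_ne_zero {c : Finset ι → ZMod 2} (hc : c ≠ 0) :
    ∃ x, multilinearEval c x ≠ 0 := by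
  obtain ⟨S₀, hS₀⟩ := Function.ne_iff.1 hc
  obtain ⟨S, -, hS⟩ := exists_minimal_le_of_wellFoundedLT (fun S => c S ≠ 0) S₀ hS₀
  refine ⟨fun i => if i ∈ S then 1 else 0, ?_⟩
  rw [multilinearEval, sum_eq_single S]
  · rw [prod_congr rfl (g := fun _ => 1) fun i hi => if_pos hi]
    simpa using hS.prop
  · intro T _ hT
    by_cases hTS : T ⊆ S
    · have : c T = 0 := by
        by_contra h
        exact hT (hS.eq_of_le h hTS)
      simp [this]
    · obtain ⟨i, hiT, hiS⟩ := not_subset.1 hTS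
      rw [prod_eq_zero hiT (if_neg hiS), mul_zero]
  · simp

theorem exists_multilinear_vanishing (D : ℕ) (Z : Finset (ι → ZMod 2))
    (hZ : #Z + chooseSum (Fintype.card ι) D < 2 ^ Fintype.card ι) :
    ∃ c : Finset ι → ZMod 2, c ≠ 0 ∧ (∀ S, c S ≠ 0 → D < #Sᶜ) ∧
      ∀ x ∈ Z, multilinearEval c x = 0 := by
  let M : Matrix Z {S : Finset ι // D < #Sᶜ} (ZMod 2) := Matrix.of fun x S => ∏ i ∈ S.1, x.1 i
  have hlt : Fintype.card Z < Fintype.card {S : Finset ι // D < #Sᶜ} := by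
    rw [Fintype.card_coe, Fintype.card_subtype]
    have := card_filter_lt_card_compl ι D
    omega
  have hker : LinearMap.ker M.mulVecLin ≠ ⊥ :=
    LinearMap.ker_ne_bot_of_finrank_lt (by simpa using hlt)
  obtain ⟨v, hv, hv0⟩ := (Submodule.ne_bot_iff _).1 hker
  have hv' : M.mulVec v = 0 := hv
  refine ⟨fun S => if h : D < #Sᶜ then v ⟨S, h⟩ else 0, ?_, ?_, ?_⟩
  · obtain ⟨S, hS⟩ := Function.ne_iff.1 hv0
    exact Function.ne_iff.2 ⟨S.1, by simpa [S.2] using hS⟩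
  · intro S hS
    by_contra h
    simp [h] at hS
  · intro x hx
    rw [multilinearEval, ← sum_filter_of_ne (p := fun S : Finset ι => D < #Sᶜ)]
    · rw [sum_subtype (p := fun S : Finset ι => D < #Sᶜ) _ (by simp)]
      refine (sum_congr rfl fun S _ => ?_).trans (congrFun hv' ⟨x, hx⟩)
      rw [dif_pos S.2, mul_comm]
      rfl
    · intro S _ hS
      by_contra h
      simp [h] at hS

/-- The coefficients of `x ^ U * y ^ V` in the expansion of `multilinearEval c (x + y)`. -/
def splitCoeff (c : Finset ι → ZMod 2) : Matrix (Finset ι) (Finset ι) (ZMod 2) :=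
  Matrix.of fun U V => if Disjoint U V then c (U ∪ V) else 0

theorem multilinearEval_add (c : Finset ι → ZMod 2) (x y : ι → ZMod 2) :
    multilinearEval c (x + y) =
      ∑ U, ∑ V, (∏ i ∈ U, x i) * splitCoeff c U V * ∏ i ∈ V, y i := by
  simp only [multilinearEval, Pi.add_apply, prod_add, mul_sum, splitCoeff, Matrix.of_apply]
  simp only [mul_ite, ite_mul, mul_zero, zero_mul, ← sum_filter]
  rw [sum_sigma', sum_sigma']
  refine sum_bij' (fun p _ => ⟨p.2, p.1 \ p.2⟩) (fun p _ => ⟨p.1 ∪ p.2, p.1⟩) ?_ ?_ ?_ ?_ ?_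
  · simp [disjoint_sdiff]
  · simp only [mem_sigma, mem_filter, mem_univ, true_and, mem_powerset]
    exact fun _ _ => subset_union_left
  · rintro ⟨S, U⟩ h
    simp only [mem_sigma, mem_univ, mem_powerset, true_and] at h
    simp [h]
  · rintro ⟨U, V⟩ h
    simp only [mem_sigma, mem_filter, mem_univ, true_and] at h
    simp [union_sdiff_cancel_left h]
  · rintro ⟨S, U⟩ h
    simp only [mem_sigma, mem_univ, mem_powerset, true_and] at h
    simp only [union_sdiff_of_subset h]
    ring

omit [Fintype ι] in
theorem splitCoeff_eq_zero {c : Finset ι → ZMod 2} {d : ℕ} (hc : ∀ S, c S ≠ 0 → #S ≤ d)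
    {U V : Finset ι} (hU : d / 2 < #U) (hV : d / 2 < #V) : splitCoeff c U V = 0 := by
  simp only [splitCoeff, Matrix.of_apply, ite_eq_right_iff]
  intro h
  by_contra hne
  have := hc _ hne
  rw [card_union_of_disjoint h] at this
  omega

/-- The diagonal projection onto the monomials of degree at most `j`. -/
def degreeProj (ι : Type*) [Fintype ι] [DecidableEq ι] (j : ℕ) :
    Matrix (Finset ι) (Finset ι) (ZMod 2) :=
  Matrix.diagonal fun S => if #S ≤ j then 1 else 0

theorem rank_degreeProj (j : ℕ) :
    (degreeProj ι j).rank = chooseSum (Fintype.card ι) j := by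
  rw [degreeProj, Matrix.rank_diagonal, ← card_filter_card_le, Fintype.card_subtype]
  simp

theorem splitCoeff_eq_add {c : Finset ι → ZMod 2} {d : ℕ} (hc : ∀ S, c S ≠ 0 → #S ≤ d) :
    splitCoeff c = degreeProj ι (d / 2) * splitCoeff c +
      (1 - degreeProj ι (d / 2)) * splitCoeff c * degreeProj ι (d / 2) := by
  ext U V
  simp only [degreeProj, sub_mul, one_mul, Matrix.add_apply, Matrix.sub_apply,
    Matrix.diagonal_mul, Matrix.mul_diagonal]
  by_cases hU : #U ≤ d / 2
  · simp [hU]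
  · by_cases hV : #V ≤ d / 2
    · simp [hU, hV]
    · simp [hU, hV, splitCoeff_eq_zero hc (not_le.1 hU) (not_le.1 hV)]

theorem multilinearEval_eq_zero_of_card_lt {c : Finset ι → ZMod 2} {d : ℕ}
    (hc : ∀ S, c S ≠ 0 → #S ≤ d) {A : Finset (ι → ZMod 2)}
    (hA : 2 * chooseSum (Fintype.card ι) (d / 2) < #A) {u : ι → ZMod 2}
    (h : ∀ a ∈ A, ∀ b ∈ A, a ≠ b → multilinearEval c (u + a + b) = 0) :
    multilinearEval c u = 0 := by
  by_contra hu
  let X : Matrix A (Finset ι) (ZMod 2) := Matrix.of fun a U => ∏ i ∈ U, (u + a.1) i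
  let Y : Matrix (Finset ι) A (ZMod 2) := Matrix.of fun V b => ∏ i ∈ V, b.1 i
  have hM : X * splitCoeff c * Y = Matrix.diagonal fun _ => multilinearEval c u := by
    ext a b
    have hab : (X * splitCoeff c * Y) a b = multilinearEval c (u + a.1 + b.1) := by
      rw [multilinearEval_add, sum_comm]
      simp only [Matrix.mul_apply, sum_mul]
      rfl
    rw [hab]
    by_cases hne : a = b
    · subst hne
      rw [Matrix.diagonal_apply_eq, add_assoc, ZModModule.add_self (G := ι → ZMod 2), add_zero]
    · rw [Matrix.diagonal_apply_ne _ hne]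
      exact h _ a.2 _ b.2 fun h' => hne (Subtype.ext h')
  have hrank : (X * splitCoeff c * Y).rank = #A := by
    rw [hM, Matrix.rank_diagonal]
    simp [hu]
  set E := degreeProj ι (d / 2) with hE
  have hsplit : X * splitCoeff c * Y =
      X * (E * (splitCoeff c * Y)) + (X * ((1 - E) * splitCoeff c)) * (E * Y) := by
    conv_lhs => rw [splitCoeff_eq_add hc]
    simp only [Matrix.mul_add, Matrix.add_mul, Matrix.mul_assoc, hE]
  have h₁ : (X * (E * (splitCoeff c * Y))).rank ≤ E.rank :=
    (Matrix.rank_mul_le_right _ _).trans (Matrix.rank_mul_le_left _ _)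
  have h₂ : ((X * ((1 - E) * splitCoeff c)) * (E * Y)).rank ≤ E.rank :=
    (Matrix.rank_mul_le_right _ _).trans (Matrix.rank_mul_le_left _ _)
  have h₃ := Matrix.rank_add_le (X * (E * (splitCoeff c * Y)))
    ((X * ((1 - E) * splitCoeff c)) * (E * Y))
  rw [← hsplit, hrank] at h₃
  have hErank : E.rank = chooseSum (Fintype.card ι) (d / 2) := rank_degreeProj _
  rw [hErank] at h₁ h₂
  omega

/-- If `u + h + h'` indexes an empty fibre whenever `h ≠ h'` lie in the fibre over `u`, then few
fibres are large. -/
theorem card_large_fibers_le (B : (ι → ZMod 2) → Finset (ι → ZMod 2))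
    (hB : ∀ u, ∀ a ∈ B u, ∀ b ∈ B u, a ≠ b → B (u + a + b) = ∅) (D : ℕ) :
    #{u | 2 * chooseSum (Fintype.card ι) ((Fintype.card ι - D - 1) / 2) < #(B u)} ≤
      chooseSum (Fintype.card ι) D := by
  by_contra! hlt
  set R : Finset (ι → ZMod 2) :=
    {u | 2 * chooseSum (Fintype.card ι) ((Fintype.card ι - D - 1) / 2) < #(B u)} with hR
  have hcard : #Rᶜ + #R = 2 ^ Fintype.card ι := by
    rw [card_compl_add_card]
    simp [ZMod.card]
  obtain ⟨c, hc0, hcD, hcR⟩ := exists_multilinear_vanishing D Rᶜ (by omega)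
  obtain ⟨u, hu⟩ := exists_multilinearEval_ne_zero hc0
  have huR : u ∈ R := by
    by_contra h
    exact hu (hcR u (mem_compl.2 h))
  refine hu (multilinearEval_eq_zero_of_card_lt (A := B u) (d := Fintype.card ι - D - 1) ?_
    (by simpa [hR] using huR) ?_)
  · intro S hS
    have h₁ := hcD S hS
    have h₂ := card_add_card_compl S
    omega
  · intro a ha b hb hab
    refine hcR _ ?_
    simp [hR, hB u a ha b hb hab]

end Polynomial

theorem chooseSum_le_two_rpow {N j : ℕ} {α : ℝ} (h₀ : 0 < α) (h₁ : α ≤ 1 / 2)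
    (hj : (j : ℝ) ≤ α * N) : (chooseSum N j : ℝ) ≤ 2 ^ ((N : ℝ) * binEnt α) := by
  have h₁' : 0 < 1 - α := by linarith
  have hjN : j ≤ N := by
    have : (j : ℝ) ≤ N := hj.trans (by nlinarith [Nat.cast_nonneg (α := ℝ) N])
    exact_mod_cast this
  have hlog : Real.logb 2 α ≤ Real.logb 2 (1 - α) :=
    Real.logb_le_logb_of_le one_lt_two h₀ (by linarith)
  have hterm : ∀ i ∈ range (j + 1),
      (2 : ℝ) ^ (-((N : ℝ) * binEnt α)) ≤ α ^ i * (1 - α) ^ (N - i) := by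
    intro i hi
    have hij : i ≤ j := Nat.lt_succ_iff.1 (mem_range.1 hi)
    have hi' : (i : ℝ) ≤ α * N := le_trans (by exact_mod_cast hij) hj
    have ha : α ^ i = (2 : ℝ) ^ (Real.logb 2 α * i) := by
      rw [Real.rpow_mul zero_le_two, Real.rpow_logb two_pos (by norm_num) h₀, Real.rpow_natCast]
    have hb : (1 - α) ^ (N - i) = (2 : ℝ) ^ (Real.logb 2 (1 - α) * (N - i : ℝ)) := by
      rw [← Nat.cast_sub (hij.trans hjN), Real.rpow_mul zero_le_two,
        Real.rpow_logb two_pos (by norm_num) h₁', Real.rpow_natCast]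
    rw [ha, hb, ← Real.rpow_add two_pos]
    refine Real.rpow_le_rpow_of_exponent_le one_le_two ?_
    rw [binEnt]
    nlinarith [mul_nonneg (sub_nonneg.2 hi') (sub_nonneg.2 hlog)]
  have hsum : (chooseSum N j : ℝ) * 2 ^ (-((N : ℝ) * binEnt α)) ≤ 1 := by
    calc (chooseSum N j : ℝ) * 2 ^ (-((N : ℝ) * binEnt α))
        = ∑ i ∈ range (j + 1), (2 : ℝ) ^ (-((N : ℝ) * binEnt α)) * N.choose i := by
          rw [chooseSum, Nat.cast_sum, sum_mul]
          exact sum_congr rfl fun i _ => mul_comm _ _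
      _ ≤ ∑ i ∈ range (j + 1), α ^ i * (1 - α) ^ (N - i) * N.choose i :=
          sum_le_sum fun i hi => mul_le_mul_of_nonneg_right (hterm i hi) (Nat.cast_nonneg _)
      _ ≤ ∑ i ∈ range (N + 1), α ^ i * (1 - α) ^ (N - i) * N.choose i :=
          sum_le_sum_of_subset_of_nonneg (range_subset_range.2 (by omega)) fun i _ _ => by positivity
      _ = 1 := by rw [← add_pow]; simp
  rwa [Real.rpow_neg zero_le_two, ← div_eq_mul_inv, div_le_one (by positivity)] at hsum

theorem chooseSum_le_two_pow (N j : ℕ) : chooseSum N j ≤ 2 ^ N := by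
  have h := card_filter_card_le (Fin N) j
  rw [Fintype.card_fin] at h
  rw [← h]
  exact (card_le_univ _).trans_eq (by simp)

theorem binEnt_eq_binEntropy_div (x : ℝ) : binEnt x = Real.binEntropy x / Real.log 2 := by
  rw [binEnt, Real.binEntropy, Real.logb, Real.logb, Real.log_inv, Real.log_inv]
  ring

theorem binEnt_le_one (x : ℝ) : binEnt x ≤ 1 := by
  rw [binEnt_eq_binEntropy_div, div_le_one (Real.log_pos one_lt_two)]
  exact Real.binEntropy_le_log_two

theorem continuous_binEnt : Continuous binEnt := by
  rw [funext binEnt_eq_binEntropy_div]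
  fun_prop

theorem le_gam {ε : ℝ} (hε : ε ∈ Set.Ioo 0 (1 / 4)) :
    1 / 2 * (binEnt (1 / 2 - ε) + binEnt (2 * ε)) ≤ gam := by
  refine le_csSup ⟨1, ?_⟩ ⟨ε, hε, rfl⟩
  rintro _ ⟨δ, -, rfl⟩
  have h₁ := binEnt_le_one (1 / 2 - δ)
  have h₂ := binEnt_le_one (2 * δ)
  dsimp only
  linarith

theorem binEnt_quarter_add_one_le : binEnt (1 / 4) + 1 ≤ 2 * gam := by
  have hlim : Filter.Tendsto (fun ε : ℝ => 1 / 2 * (binEnt (1 / 2 - ε) + binEnt (2 * ε)))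
      (nhdsWithin (1 / 4) (Set.Iio (1 / 4)))
      (nhds (1 / 2 * (binEnt (1 / 2 - 1 / 4) + binEnt (2 * (1 / 4))))) := by
    refine Filter.Tendsto.mono_left (Continuous.tendsto ?_ _) nhdsWithin_le_nhds
    have := continuous_binEnt
    fun_prop
  have hle := le_of_tendsto hlim (b := gam) <|
    Filter.mem_of_superset (Ioo_mem_nhdsLT (by norm_num : (0 : ℝ) < 1 / 4)) fun ε hε => le_gam hε
  have hhalf : binEnt (1 / 2) = 1 := by
    rw [binEnt_eq_binEntropy_div, one_div, Real.binEntropy_two_inv,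
      div_self (Real.log_pos one_lt_two).ne']
  norm_num [hhalf] at hle ⊢
  linarith

theorem one_le_two_mul_gam : 1 ≤ 2 * gam := by
  have h : 0 ≤ binEnt (1 / 4) := by
    rw [binEnt_eq_binEntropy_div]
    exact div_nonneg (Real.binEntropy_nonneg (by norm_num) (by norm_num))
      (Real.log_pos one_lt_two).le
  linarith [binEnt_quarter_add_one_le]

theorem sum_le_sum_layers {α : Type*} [Fintype α] (f : α → ℕ) (T S : ℕ → ℕ) (N : ℕ)
    (hT : ∀ x, f x ≤ T 0) (hS : ∀ D < N, #{x | T (D + 1) < f x} ≤ S (D + 1))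
    (hN : Fintype.card α ≤ S (N + 1)) :
    ∑ x, f x ≤ ∑ D ∈ range (N + 1), T D * S (D + 1) := by
  classical
  have hlayer : ∀ x, ∃ D ∈ range (N + 1), f x ≤ T D ∧ (D = N ∨ T (D + 1) < f x) := by
    intro x
    have hex : ∃ D, D = N ∨ T (D + 1) < f x := ⟨N, .inl rfl⟩
    refine ⟨Nat.find hex, ?_, ?_, Nat.find_spec hex⟩
    · exact mem_range.2 (Nat.lt_succ_iff.2 (Nat.find_min' hex (.inl rfl)))
    · rcases hD : Nat.find hex with _ | D
      · exact hT x
      · have := Nat.find_min hex (m := D) (by omega)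
        push Not at this
        exact this.2
  calc ∑ x, f x
      ≤ ∑ x, ∑ D ∈ range (N + 1), if D = N ∨ T (D + 1) < f x then T D else 0 := by
        refine sum_le_sum fun x _ => ?_
        obtain ⟨D, hD, hfD, h⟩ := hlayer x
        refine hfD.trans ?_
        exact (if_pos h).ge.trans (single_le_sum
          (f := fun D => if D = N ∨ T (D + 1) < f x then T D else 0) (by simp) hD)
    _ = ∑ D ∈ range (N + 1), T D * #{x | D = N ∨ T (D + 1) < f x} := by
        rw [sum_comm]
        refine sum_congr rfl fun D _ => ?_
        rw [← sum_filter, sum_const, smul_eq_mul, mul_comm]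
    _ ≤ ∑ D ∈ range (N + 1), T D * S (D + 1) := by
        refine sum_le_sum fun D hD => Nat.mul_le_mul_left _ ?_
        by_cases h : D = N
        · simpa [h] using hN
        · simpa [h] using hS D (by have := mem_range.1 hD; omega)

/-- The fibre sizes that separate successive layers in the count of a progression-free set:
`card_large_fibers_le` bounds the number of fibres larger than each of them. -/
def layerHeight (N D : ℕ) : ℕ :=
  if D = 0 then 2 ^ N else 2 * chooseSum N ((N - D - 1) / 2)

theorem layerHeight_mul_chooseSum_le (N D : ℕ) :
    ((layerHeight N D * chooseSum N (D + 1) : ℕ) : ℝ) ≤ 2 * (N + 1) * 4 ^ (gam * N) := by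
  have hN : (0 : ℝ) ≤ N := N.cast_nonneg
  have h4 : (4 : ℝ) ^ (gam * N) = 2 ^ (N * (2 * gam)) := by
    rw [show (4 : ℝ) = 2 ^ (2 : ℝ) by norm_num, ← Real.rpow_mul zero_le_two]
    ring_nf
  have hpow : ∀ {s : ℝ}, s ≤ 2 * gam → (2 : ℝ) ^ (N * s) ≤ 4 ^ (gam * N) := fun hs => by
    rw [h4]
    exact Real.rpow_le_rpow_of_exponent_le one_le_two (mul_le_mul_of_nonneg_left hs hN)
  have hmul : ∀ {x y a b : ℝ}, 0 ≤ y → x ≤ 2 ^ (N * a) → y ≤ 2 ^ (N * b) → a + b ≤ 2 * gam →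
      2 * x * y ≤ 2 * (N + 1) * 4 ^ (gam * N) := by
    intro x y a b hy hx hy' hab
    have h : x * y ≤ 4 ^ (gam * N) := by
      refine (mul_le_mul hx hy' hy (by positivity)).trans ?_
      rw [← Real.rpow_add two_pos, ← mul_add]
      exact hpow hab
    have h' : 0 ≤ N * (4 : ℝ) ^ (gam * N) := by positivity
    nlinarith
  have hone : (chooseSum N (D + 1) : ℝ) ≤ 2 ^ ((N : ℝ) * 1) := by
    rw [mul_one, Real.rpow_natCast]
    exact_mod_cast chooseSum_le_two_pow N (D + 1)
  rw [layerHeight]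
  split_ifs with hD
  · have h : (2 : ℝ) ^ N ≤ 4 ^ (gam * N) := by
      simpa using hpow one_le_two_mul_gam
    have h' : chooseSum N 1 = N + 1 := by simp [chooseSum, sum_range_succ, add_comm]
    subst hD
    rw [zero_add, h']
    push_cast
    nlinarith [mul_le_mul_of_nonneg_right h (by positivity : (0 : ℝ) ≤ N + 1),
      (by positivity : (0 : ℝ) ≤ (N + 1) * 4 ^ (gam * N))]
  push_cast
  by_cases hlt : 2 * (D + 1) < N
  · have hN0 : (0 : ℝ) < N := by exact_mod_cast (by omega : 0 < N)
    have hlt' : 2 * ((D : ℝ) + 1) < N := by exact_mod_cast hlt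
    set ε : ℝ := (D + 1) / (2 * N) with hε
    have hεN : ε * N = (D + 1) / 2 := by rw [hε]; field_simp
    have hε0 : 0 < ε := by positivity
    have hε4 : ε < 1 / 4 := by rw [hε, div_lt_iff₀ (by positivity)]; linarith
    refine hmul (Nat.cast_nonneg _)
      (chooseSum_le_two_rpow (α := 1 / 2 - ε) (by linarith) (by linarith) ?_)
      (chooseSum_le_two_rpow (α := 2 * ε) (by linarith) (by linarith) ?_)
      (by linarith [le_gam ⟨hε0, hε4⟩])
    · have : (((N - D - 1) / 2 : ℕ) : ℝ) * 2 + D + 1 ≤ N := by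
        exact_mod_cast (by omega : (N - D - 1) / 2 * 2 + D + 1 ≤ N)
      linarith
    · push_cast
      linarith
  · refine hmul (Nat.cast_nonneg _)
      (chooseSum_le_two_rpow (α := 1 / 4) (by norm_num) (by norm_num) ?_) hone
      binEnt_quarter_add_one_le
    have : (((N - D - 1) / 2 : ℕ) : ℝ) * 4 ≤ N := by
      exact_mod_cast (by omega : (N - D - 1) / 2 * 4 ≤ N)
    linarith

section ZModFour

variable {ι : Type*} [Fintype ι] [DecidableEq ι]

/-- The element of `(ℤ/4)^ι` with lower binary digits `u` and upper binary digits `h`. -/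
def ofDigits (u h : ι → ZMod 2) : ι → ZMod 4 := fun i => (u i).val + 2 * (h i).val

omit [Fintype ι] [DecidableEq ι] in
theorem ofDigits_injective :
    Function.Injective fun p : (ι → ZMod 2) × (ι → ZMod 2) => ofDigits p.1 p.2 := by
  have key : ∀ u h u' h' : ZMod 2, (u.val + 2 * h.val : ZMod 4) = u'.val + 2 * h'.val →
      u = u' ∧ h = h' := by decide
  rintro ⟨u, h⟩ ⟨u', h'⟩ heq
  have := fun i => key _ _ _ _ (congrFun heq i)
  exact Prod.ext (funext fun i => (this i).1) (funext fun i => (this i).2)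

omit [Fintype ι] [DecidableEq ι] in
theorem ofDigits_add_ofDigits (u a b w : ι → ZMod 2) :
    ofDigits u a + ofDigits u b = ofDigits (u + a + b) w + ofDigits (u + a + b) w := by
  have key : ∀ u a b w : ZMod 2, (u.val + 2 * a.val : ZMod 4) + (u.val + 2 * b.val) =
      ((u + a + b).val + 2 * w.val) + ((u + a + b).val + 2 * w.val) := by decide
  exact funext fun i => key _ _ _ _

theorem ProgressionFree.eq_of_add_eq {G : Type*} [AddCommGroup G] {A : Set G}
    (hA : ProgressionFree A) {a b c : G} (ha : a ∈ A) (hb : b ∈ A) (hc : c ∈ A)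
    (h : a + b = c + c) : a = b := by
  by_contra hab
  refine hA ⟨a, ha, b, hb, c, hc, hab, ?_, ?_, h⟩
  · rintro rfl
    exact hab (add_left_cancel h).symm
  · rintro rfl
    exact hab (add_right_cancel h)

theorem card_le_poly_mul {A : Finset (ι → ZMod 4)} (hA : ProgressionFree (A : Set (ι → ZMod 4))) :
    (#A : ℝ) ≤ 2 * (Fintype.card ι + 1) ^ 2 * 4 ^ (gam * Fintype.card ι) := by
  set N := Fintype.card ι with hN
  let B : (ι → ZMod 2) → Finset (ι → ZMod 2) := fun u => {h | ofDigits u h ∈ A}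
  have hBmem : ∀ {u h}, h ∈ B u ↔ ofDigits u h ∈ A := by simp [B]
  have hcard : #A = ∑ u, #(B u) := by
    have hbij : Function.Bijective fun p : (ι → ZMod 2) × (ι → ZMod 2) => ofDigits p.1 p.2 := by
      rw [Fintype.bijective_iff_injective_and_card]
      refine ⟨ofDigits_injective, ?_⟩
      simp [ZMod.card, ← mul_pow]
    rw [← card_sigma]
    refine (card_bij (fun p _ => ofDigits p.1 p.2) ?_ ?_ ?_).symm
    · rintro ⟨u, h⟩ hp
      exact hBmem.1 (mem_sigma.1 hp).2
    · rintro ⟨u, h⟩ - ⟨u', h'⟩ - heq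
      have := @ofDigits_injective ι (u, h) (u', h') heq
      simp_all
    · intro x hx
      obtain ⟨⟨u, h⟩, rfl⟩ := hbij.2 x
      exact ⟨⟨u, h⟩, mem_sigma.2 ⟨mem_univ _, hBmem.2 hx⟩, rfl⟩
  have hB : ∀ u, ∀ a ∈ B u, ∀ b ∈ B u, a ≠ b → B (u + a + b) = ∅ := by
    intro u a ha b hb hab
    refine eq_empty_of_forall_notMem fun w hw => hab ?_
    have := hA.eq_of_add_eq (hBmem.1 ha) (hBmem.1 hb) (hBmem.1 hw) (ofDigits_add_ofDigits u a b w)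
    exact (Prod.ext_iff.1 (@ofDigits_injective ι (u, a) (u, b) this)).2
  have hsum := sum_le_sum_layers (fun u => #(B u)) (layerHeight N) (chooseSum N) N
    (fun u => by
      refine (card_le_univ (B u)).trans ?_
      simp [layerHeight, ZMod.card, hN])
    (fun D _ => by
      simpa [layerHeight, hN] using card_large_fibers_le B hB (D + 1))
    (by
      rw [chooseSum, ← sum_subset (range_subset_range.2 (by omega : N + 1 ≤ N + 1 + 1))]
      · simp [Nat.sum_range_choose, ZMod.card, hN]
      · intro i _ hi
        exact Nat.choose_eq_zero_of_lt (by simpa using hi))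
  rw [← hcard] at hsum
  calc (#A : ℝ) ≤ ∑ D ∈ range (N + 1), ((layerHeight N D * chooseSum N (D + 1) : ℕ) : ℝ) := by
        exact_mod_cast hsum
    _ ≤ ∑ D ∈ range (N + 1), 2 * (N + 1) * (4 : ℝ) ^ (gam * N) :=
        sum_le_sum fun D _ => layerHeight_mul_chooseSum_le N D
    _ = 2 * (N + 1) ^ 2 * 4 ^ (gam * N) := by
        rw [sum_const, card_range, nsmul_eq_mul]
        push_cast
        ring

theorem le_of_pow_le_poly_mul_pow {x y : ℝ} (hy : 0 < y) (N : ℕ)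
    (h : ∀ k : ℕ, x ^ k ≤ 2 * (k * N + 1) ^ 2 * y ^ k) : x ≤ y := by
  by_contra! hlt
  have hr : 1 < x / y := (one_lt_div hy).2 hlt
  have hlim := (tendsto_pow_const_div_const_pow_of_one_lt 2 hr).const_mul (2 * ((N : ℝ) + 1) ^ 2)
  have hle : (1 : ℝ) ≤ 2 * ((N : ℝ) + 1) ^ 2 * 0 := by
    refine ge_of_tendsto hlim (Filter.eventually_atTop.2 ⟨1, fun k hk => ?_⟩)
    have hk' : (1 : ℝ) ≤ k := by exact_mod_cast hk
    have hpow : (0 : ℝ) < (x / y) ^ k := by positivity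
    rw [← mul_div_assoc, le_div_iff₀ hpow, one_mul, div_pow, div_le_iff₀ (by positivity)]
    refine (h k).trans (mul_le_mul_of_nonneg_right ?_ (by positivity))
    rw [mul_assoc, ← mul_pow]
    have hN : (0 : ℝ) ≤ N := N.cast_nonneg
    gcongr
    nlinarith
  norm_num at hle

theorem card_le_four_rpow {A : Finset (ι → ZMod 4)}
    (hA : ProgressionFree (A : Set (ι → ZMod 4))) :
    (#A : ℝ) ≤ 4 ^ (gam * Fintype.card ι) := by
  refine le_of_pow_le_poly_mul_pow (by positivity) (Fintype.card ι) fun k => ?_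
  let P : Finset (Fin k × ι → ZMod 4) :=
    (Fintype.piFinset fun _ : Fin k => A).map (Equiv.curry (Fin k) ι (ZMod 4)).symm.toEmbedding
  have hPmem : ∀ {f}, f ∈ P ↔ ∀ j, (fun i => f (j, i)) ∈ A := by
    intro f
    rw [mem_map_equiv, Fintype.mem_piFinset]
    rfl
  have hP : ProgressionFree (P : Set (Fin k × ι → ZMod 4)) := by
    rintro ⟨a, ha, b, hb, c, hc, hab, -, -, h⟩
    refine hab (funext fun p => ?_)
    exact congrFun (hA.eq_of_add_eq (hPmem.1 ha p.1) (hPmem.1 hb p.1) (hPmem.1 hc p.1)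
      (funext fun i => congrFun h (p.1, i))) p.2
  have hcard := card_le_poly_mul hP
  rw [card_map, Fintype.card_piFinset_const, Fintype.card_prod, Fintype.card_fin] at hcard
  push_cast at hcard
  rwa [mul_left_comm, mul_comm (k : ℝ) (gam * _), Real.rpow_mul (by norm_num), Real.rpow_natCast]
    at hcard

theorem card_mul_le_of_injective {G : Type*} [AddCommGroup G] [Fintype G] {A : Finset G}
    (hA : ProgressionFree (A : Set G)) (ψ : (ι → ZMod 4) →+ G) (hψ : Function.Injective ψ) :
    (#A : ℝ) * 4 ^ Fintype.card ι ≤ 4 ^ (gam * Fintype.card ι) * Fintype.card G := by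
  classical
  have hfib : ∀ g : G, (#{x : ι → ZMod 4 | g + ψ x ∈ A} : ℝ) ≤ 4 ^ (gam * Fintype.card ι) := by
    intro g
    refine card_le_four_rpow ?_
    rintro ⟨a, ha, b, hb, c, hc, hab, -, -, h⟩
    simp only [coe_filter, mem_univ, true_and, Set.mem_ofPred_eq] at ha hb hc
    refine hab (hψ (add_left_cancel (a := g) (hA.eq_of_add_eq ha hb hc ?_)))
    rw [add_add_add_comm, add_add_add_comm g (ψ c), ← map_add, ← map_add, h]
  have hcount : #A * 4 ^ Fintype.card ι = ∑ g : G, #{x : ι → ZMod 4 | g + ψ x ∈ A} := by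
    simp only [card_filter]
    rw [sum_comm]
    have : ∀ x : ι → ZMod 4, ∑ g : G, (if g + ψ x ∈ A then 1 else 0) = #A := fun x => by
      refine (Equiv.sum_comp (Equiv.addRight (ψ x)) fun g => if g ∈ A then 1 else 0).trans ?_
      simp
    simp [this, ZMod.card, mul_comm]
  calc (#A : ℝ) * 4 ^ Fintype.card ι = ∑ g : G, (#{x : ι → ZMod 4 | g + ψ x ∈ A} : ℝ) := by
        exact_mod_cast hcount
    _ ≤ ∑ _g : G, (4 : ℝ) ^ (gam * Fintype.card ι) := sum_le_sum fun g _ => hfib g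
    _ = _ := by rw [sum_const, card_univ, nsmul_eq_mul, mul_comm]

end ZModFour

theorem exists_injective_zmodFour {m : ℕ} (hm : 0 < m) (h : 4 ∣ m) :
    ∃ φ : ZMod 4 →+ ZMod m, Function.Injective φ := by
  obtain ⟨t, rfl⟩ := h
  let f : {f : ℤ →+ ZMod (4 * t) // f (4 : ℕ) = 0} :=
    ⟨zmultiplesHom _ (t : ZMod (4 * t)), by
      have := ZMod.natCast_self (4 * t)
      push_cast at this
      simpa using this⟩
  refine ⟨ZMod.lift 4 f, (ZMod.lift_injective (f := f)).2 fun j hj => ?_⟩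
  have hj' : ((j * t : ℤ) : ZMod (4 * t)) = 0 := by simpa [f] using hj
  rw [ZMod.intCast_zmod_eq_zero_iff_dvd] at hj'
  rw [ZMod.intCast_zmod_eq_zero_iff_dvd]
  push_cast at hj' ⊢
  exact Int.dvd_of_mul_dvd_mul_right (by omega) hj'

theorem exists_injective_pi_zmodFour {κ : Type*} (m : κ → ℕ) (hm : ∀ i, 0 < m i) :
    ∃ ψ : ({i // 4 ∣ m i} → ZMod 4) →+ ((i : κ) → ZMod (m i)), Function.Injective ψ := by
  classical
  choose φ hφ using fun i : {i // 4 ∣ m i} => exists_injective_zmodFour (hm i) i.2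
  refine ⟨AddMonoidHom.mk' (fun x i => if h : 4 ∣ m i then φ ⟨i, h⟩ (x ⟨i, h⟩) else 0) ?_, ?_⟩
  · intro x y
    ext i
    by_cases h : 4 ∣ m i <;> simp [h]
  · intro x y hxy
    funext i
    refine hφ i ?_
    simpa [i.2] using congrFun hxy i.1

theorem r3_le_of_rank4 (G : Type*) [AddCommGroup G] [Fintype G]
    (k : ℕ) (m : Fin k → ℕ) (hm : ∀ i, 0 < m i)
    (hchain : ∀ i j : Fin k, i ≤ j → m i ∣ m j)
    (e : G ≃+ ((i : Fin k) → ZMod (m i)))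
    (n : ℕ) (hn : n = (Finset.univ.filter fun i : Fin k => 4 ∣ m i).card) :
    (r3 G : ℝ) ≤ (4 : ℝ) ^ (-(1 - gam) * n) * Fintype.card G := by
  classical
  have hcardι : Fintype.card {i // 4 ∣ m i} = n := by rw [Fintype.card_subtype, hn]
  obtain ⟨ψ, hψ⟩ := exists_injective_pi_zmodFour m hm
  let S : Set ℕ := {N | ∃ A : Finset G, ProgressionFree (A : Set G) ∧ #A = N}
  have hS : r3 G ∈ S := by
    refine Nat.sSup_mem ⟨0, ∅, ?_, card_empty⟩ ⟨Fintype.card G, ?_⟩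
    · rintro ⟨a, ha, -⟩
      simp at ha
    · rintro _ ⟨A, -, rfl⟩
      exact card_le_univ A
  obtain ⟨A, hA, hAcard⟩ := hS
  have h := card_mul_le_of_injective hA (e.symm.toAddMonoidHom.comp ψ)
    (e.symm.injective.comp hψ)
  rw [hcardι, hAcard, ← le_div_iff₀ (by positivity)] at h
  refine h.trans_eq ?_
  rw [show -(1 - gam) * (n : ℝ) = gam * n - n by ring, Real.rpow_sub (by norm_num),
    Real.rpow_natCast]
  ring
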